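/- arXiv:1705.03830 — 2 statements merged into one kernel-verified Lean document; each statement's English description precedes it below -/
import Mathlib

section
/- Let q ≥ 1, let ν be a finite Borel measure on ℝ^q, fix θ₀ ∈ ℝ^q and τ > 0 with ‖θ₀‖ ≤ τ, and assume ∫ (1 + ‖y‖) e^{τ‖y‖} dν(y) < ∞. Define g(θ) := ∫ (⟨θ, y⟩ e^{⟨θ₀, y⟩} − e^{⟨θ, y⟩}) dν(y) for θ ∈ ℝ^q with ‖θ‖ ≤ τ. If ν is identifiable, i.e. ⟨θ, y⟩ = 0 for ν-almost every y implies θ = 0, then for every θ with ‖θ‖ ≤ τ and θ ≠ θ₀ one has g(θ) < g(θ₀); that is, θ₀ is the unique maximizer of g on the closed ball of radius τ. -/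
open scoped RealInnerProductSpace
open MeasureTheory

lemma mul_exp_sub_exp_le (a b : ℝ) :
    b * Real.exp a - Real.exp b ≤ a * Real.exp a - Real.exp a := by
  have h := mul_le_mul_of_nonneg_left (Real.add_one_le_exp (b - a)) (Real.exp_pos a).le
  rw [← Real.exp_add, add_sub_cancel] at h
  linarith

lemma mul_exp_sub_exp_lt {a b : ℝ} (hab : b ≠ a) :
    b * Real.exp a - Real.exp b < a * Real.exp a - Real.exp a := by
  have h := mul_lt_mul_of_pos_left (Real.add_one_lt_exp (sub_ne_zero.2 hab)) (Real.exp_pos a)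
  rw [← Real.exp_add, add_sub_cancel] at h
  linarith

lemma integrable_inner_mul_exp_sub_exp {E : Type*} [NormedAddCommGroup E]
    [InnerProductSpace ℝ E] [MeasurableSpace E] [BorelSpace E] [SecondCountableTopology E]
    {ν : Measure E} {θ₀ θ : E} {τ : ℝ} (hθ₀ : ‖θ₀‖ ≤ τ) (hθ : ‖θ‖ ≤ τ)
    (hint : Integrable (fun y => (1 + ‖y‖) * Real.exp (τ * ‖y‖)) ν) :
    Integrable (fun y => ⟪θ, y⟫ * Real.exp ⟪θ₀, y⟫ - Real.exp ⟪θ, y⟫) ν := by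
  refine (hint.const_mul (τ + 1)).mono' (Continuous.aestronglyMeasurable (by fun_prop))
    (ae_of_all _ fun y => ?_)
  have hτ : 0 ≤ τ := (norm_nonneg θ).trans hθ
  have abs_inner_le {η : E} (hη : ‖η‖ ≤ τ) : |⟪η, y⟫| ≤ τ * ‖y‖ :=
    (abs_real_inner_le_norm η y).trans (by gcongr)
  calc ‖⟪θ, y⟫ * Real.exp ⟪θ₀, y⟫ - Real.exp ⟪θ, y⟫‖
      ≤ |⟪θ, y⟫| * Real.exp ⟪θ₀, y⟫ + Real.exp ⟪θ, y⟫ := by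
        refine (norm_sub_le _ _).trans_eq ?_
        simp
    _ ≤ (τ * ‖y‖) * Real.exp (τ * ‖y‖) + Real.exp (τ * ‖y‖) := by
        gcongr
        exacts [abs_inner_le hθ, le_of_abs_le (abs_inner_le hθ₀), le_of_abs_le (abs_inner_le hθ)]
    _ = (τ * ‖y‖ + 1) * Real.exp (τ * ‖y‖) := by ring
    _ ≤ ((τ + 1) * (1 + ‖y‖)) * Real.exp (τ * ‖y‖) := by
        gcongr
        nlinarith [norm_nonneg y]
    _ = (τ + 1) * ((1 + ‖y‖) * Real.exp (τ * ‖y‖)) := by ring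

/-- Uniqueness of the maximizer of the limit criterion `g` under the
identifiability assumption (A5) of the paper. -/
theorem stmt_2 (q : ℕ) (hq : 1 ≤ q)
    (ν : Measure (EuclideanSpace ℝ (Fin q))) [IsFiniteMeasure ν]
    (θ₀ : EuclideanSpace ℝ (Fin q)) (τ : ℝ) (hτ : 0 < τ) (hθ₀ : ‖θ₀‖ ≤ τ)
    (hint : Integrable (fun y => (1 + ‖y‖) * Real.exp (τ * ‖y‖)) ν)
    (g : EuclideanSpace ℝ (Fin q) → ℝ)
    (hg : ∀ θ, g θ = ∫ y, (⟪θ, y⟫ * Real.exp ⟪θ₀, y⟫ - Real.exp ⟪θ, y⟫) ∂ν)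
    (hident : ∀ θ : EuclideanSpace ℝ (Fin q), (∀ᵐ y ∂ν, ⟪θ, y⟫ = 0) → θ = 0) :
    ∀ θ : EuclideanSpace ℝ (Fin q), ‖θ‖ ≤ τ → θ ≠ θ₀ → g θ < g θ₀ := by
  intro θ hθ hne
  have hi := integrable_inner_mul_exp_sub_exp hθ₀ hθ hint
  have hi₀ := integrable_inner_mul_exp_sub_exp hθ₀ hθ₀ hint
  have hle := fun y => mul_exp_sub_exp_le ⟪θ₀, y⟫ ⟪θ, y⟫
  rw [hg, hg]
  refine (integral_mono hi hi₀ hle).lt_of_ne fun heq => hne ?_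
  have hae := (integral_eq_iff_of_ae_le hi hi₀ (ae_of_all _ hle)).1 heq
  refine sub_eq_zero.1 (hident _ ?_)
  filter_upwards [hae] with y hy
  rw [inner_sub_left, sub_eq_zero]
  by_contra hab
  exact (mul_exp_sub_exp_lt hab).ne hy
end

section
/- Let q ≥ 1, Θ ⊂ ℝ^q compact and convex, t₀ ∈ ℝ, h₀ > 0, and let g : Θ × [t₀ − h₀, t₀ + h₀] → ℝ be continuous such that: (i) for every θ ∈ Θ the map s ↦ g(θ, s) is differentiable with |∂_s g(θ, s)| ≤ M uniformly; (ii) for every s ∈ [t₀ − h₀, t₀ + h₀] the map θ ↦ g(θ, s) is strictly concave on Θ; (iii) g(·, t₀) has unique maximizer θ* ∈ Θ. Let K : ℝ → ℝ be nonnegative, supported on [−1, 1], with ∫_{−1}^1 K(u) du = 1. Then for every h ∈ (0, h₀] the function G_h(θ) := ∫_{−1}^1 K(u) g(θ, t₀ + u h) du has a unique maximizer θ_h over Θ, and θ_h → θ* as h → 0⁺. -/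
open MeasureTheory

section KernelAverage

open Set Filter Topology

variable {E : Type*} {Θ : Set E} {K : ℝ → ℝ}

/-- If a real-valued function is continuous on a compact set, uniform approximation within a
vanishing error forces its approximate maximizers to converge to its unique maximizer. -/
theorem tendsto_of_isMaxOn_of_uniform_approx [TopologicalSpace E] (hΘc : IsCompact Θ)
    {f : E → ℝ} (hf : ContinuousOn f Θ) {x₀ : E} (hx₀ : x₀ ∈ Θ)
    (hmax : ∀ x ∈ Θ, x ≠ x₀ → f x < f x₀) {ι : Type*} {l : Filter ι}
    {F : ι → E → ℝ} {ε : ι → ℝ} (hε : Tendsto ε l (𝓝 0))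
    (happrox : ∀ᶠ i in l, ∀ x ∈ Θ, |F i x - f x| ≤ ε i)
    {x : ι → E} (hx : ∀ᶠ i in l, x i ∈ Θ ∧ IsMaxOn (F i) Θ (x i)) :
    Tendsto x l (𝓝 x₀) := by
  rw [tendsto_nhds]
  intro U hU hx₀U
  rcases (Θ \ U).eq_empty_or_nonempty with hempty | hne
  · filter_upwards [hx] with i hi
    exact sdiff_eq_empty.mp hempty hi.1
  · obtain ⟨y, hy, hymax⟩ := (hΘc.diff hU).exists_isMaxOn hne (hf.mono sdiff_subset)
    have hlt : f y < f x₀ := hmax y hy.1 fun h => hy.2 (h ▸ hx₀U)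
    have hsmall : ∀ᶠ i in l, ε i < (f x₀ - f y) / 2 :=
      hε.eventually_lt_const (by linarith)
    filter_upwards [hx, happrox, hsmall] with i hi hap hsm
    by_contra hnot
    have h1 : f (x i) ≤ f y := hymax ⟨hi.1, hnot⟩
    have h2 : F i x₀ ≤ F i (x i) := hi.2 hx₀
    have h3 := abs_le.mp (hap _ hi.1)
    have h4 := abs_le.mp (hap _ hx₀)
    linarith [h3.2, h4.1]

theorem continuousOn_intervalIntegral_kernel_mul [TopologicalSpace E] [FirstCountableTopology E]
    (hΘc : IsCompact Θ) {a b : ℝ} (hab : a ≤ b) (hK : IntervalIntegrable K volume a b)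
    {f : E → ℝ → ℝ} (hf : ContinuousOn (fun p : E × ℝ => f p.1 p.2) (Θ ×ˢ Icc a b)) :
    ContinuousOn (fun x => ∫ u in a..b, K u * f x u) Θ := by
  obtain ⟨C, hC⟩ := (hΘc.prod isCompact_Icc).exists_bound_of_continuousOn hf
  have hsec : ∀ x ∈ Θ, ContinuousOn (f x) (uIcc a b) := fun x hx =>
    hf.comp (f := fun u => (x, u)) (by fun_prop) fun u hu => ⟨hx, by rwa [uIcc_of_le hab] at hu⟩
  have hIcc : ∀ u ∈ uIoc a b, u ∈ Icc a b := fun u hu => by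
    rw [uIoc_of_le hab] at hu
    exact Ioc_subset_Icc_self hu
  intro x hx
  refine intervalIntegral.continuousWithinAt_of_dominated_interval
    (bound := fun u => ‖K u‖ * C) ?_ ?_ (hK.norm.mul_const C) ?_
  · filter_upwards [self_mem_nhdsWithin] with y hy
    exact (intervalIntegrable_iff.mp (hK.mul_continuousOn (hsec y hy))).aestronglyMeasurable
  · filter_upwards [self_mem_nhdsWithin] with y hy
    refine Eventually.of_forall fun u hu => ?_
    rw [norm_mul]
    exact mul_le_mul_of_nonneg_left (hC (y, u) ⟨hy, hIcc u hu⟩) (norm_nonneg _)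
  · refine Eventually.of_forall fun u hu => ?_
    exact continuousWithinAt_const.mul
      ((hf (x, u) ⟨hx, hIcc u hu⟩).comp (f := fun y => (y, u)) (by fun_prop)
        fun y hy => ⟨hy, hIcc u hu⟩)

theorem intervalIntegral_kernel_mul_pos {a b : ℝ} (hab : a ≤ b)
    (hK : IntervalIntegrable K volume a b) (hK0 : ∀ u ∈ Icc a b, 0 ≤ K u)
    (hKpos : 0 < ∫ u in a..b, K u)
    {f : ℝ → ℝ} (hf : ContinuousOn f (Icc a b)) (hfpos : ∀ u ∈ Icc a b, 0 < f u) :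
    0 < ∫ u in a..b, K u * f u := by
  obtain ⟨v, hv, hvmin⟩ := isCompact_Icc.exists_isMinOn (nonempty_Icc.mpr hab) hf
  calc 0 < (∫ u in a..b, K u) * f v := mul_pos hKpos (hfpos v hv)
    _ = ∫ u in a..b, K u * f v := (intervalIntegral.integral_mul_const _ _).symm
    _ ≤ ∫ u in a..b, K u * f u :=
      intervalIntegral.integral_mono_on hab (hK.mul_const _)
        (hK.mul_continuousOn (by rwa [uIcc_of_le hab]))
        fun u hu => mul_le_mul_of_nonneg_left (hvmin hu) (hK0 u hu)

theorem strictConcaveOn_intervalIntegral_kernel_mul [AddCommMonoid E] [Module ℝ E]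
    (hΘ : Convex ℝ Θ) {a b : ℝ} (hab : a ≤ b)
    (hK : IntervalIntegrable K volume a b) (hK0 : ∀ u ∈ Icc a b, 0 ≤ K u)
    (hKpos : 0 < ∫ u in a..b, K u)
    {f : E → ℝ → ℝ} (hf : ∀ x ∈ Θ, ContinuousOn (f x) (Icc a b))
    (hconc : ∀ u ∈ Icc a b, StrictConcaveOn ℝ Θ (fun x => f x u)) :
    StrictConcaveOn ℝ Θ (fun x => ∫ u in a..b, K u * f x u) := by
  refine ⟨hΘ, fun x hx y hy hxy c d hc hd hcd => ?_⟩
  have hz : c • x + d • y ∈ Θ := hΘ hx hy hc.le hd.le hcd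
  have hint : ∀ w ∈ Θ, IntervalIntegrable (fun u => K u * f w u) volume a b := fun w hw =>
    hK.mul_continuousOn (by rw [uIcc_of_le hab]; exact hf w hw)
  have hpos := intervalIntegral_kernel_mul_pos hab hK hK0 hKpos
    (f := fun u => f (c • x + d • y) u - (c * f x u + d * f y u))
    ((hf _ hz).sub ((continuousOn_const.mul (hf x hx)).add (continuousOn_const.mul (hf y hy))))
    fun u hu => sub_pos.mpr ((hconc u hu).2 hx hy hxy hc hd hcd)
  have heq : (∫ u in a..b, K u * (f (c • x + d • y) u - (c * f x u + d * f y u))) =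
      (∫ u in a..b, K u * f (c • x + d • y) u) -
        (c * (∫ u in a..b, K u * f x u) + d * ∫ u in a..b, K u * f y u) := by
    rw [← intervalIntegral.integral_const_mul, ← intervalIntegral.integral_const_mul,
      ← intervalIntegral.integral_add ((hint x hx).const_mul c) ((hint y hy).const_mul d),
      ← intervalIntegral.integral_sub (hint _ hz)
        (((hint x hx).const_mul c).add ((hint y hy).const_mul d))]
    congr 1 with u
    ring
  rw [heq] at hpos
  simpa only [smul_eq_mul] using sub_pos.mp hpos

theorem abs_intervalIntegral_kernel_mul_sub_le {a b : ℝ} (hab : a ≤ b)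
    (hK : IntervalIntegrable K volume a b) (hK0 : ∀ u ∈ Icc a b, 0 ≤ K u)
    (hK1 : ∫ u in a..b, K u = 1) {f : ℝ → ℝ} (hf : ContinuousOn f (Icc a b)) {c ε : ℝ}
    (hε : ∀ u ∈ Icc a b, |f u - c| ≤ ε) :
    |(∫ u in a..b, K u * f u) - c| ≤ ε := by
  have hint : IntervalIntegrable (fun u => K u * f u) volume a b :=
    hK.mul_continuousOn (by rwa [uIcc_of_le hab])
  have hconst : ∀ r : ℝ, ∫ u in a..b, K u * r = r := fun r => by
    rw [intervalIntegral.integral_mul_const, hK1, one_mul]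
  have hle := intervalIntegral.integral_mono_on hab hint (hK.mul_const (c + ε)) fun u hu =>
    mul_le_mul_of_nonneg_left (by linarith [(abs_le.mp (hε u hu)).2]) (hK0 u hu)
  have hge := intervalIntegral.integral_mono_on hab (hK.mul_const (c - ε)) hint fun u hu =>
    mul_le_mul_of_nonneg_left (by linarith [(abs_le.mp (hε u hu)).1]) (hK0 u hu)
  rw [hconst] at hle hge
  exact abs_le.mpr ⟨by linarith, by linarith⟩

end KernelAverage

open MeasureTheory

/-- Lemma 4.2 (lem:theta0ntothetat0t0) of the paper: for each small bandwidth
`h` the kernel-localized criterion `G_h(θ) = ∫ K(u) g(θ, t₀+uh) du` has a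
unique maximizer `θ_h` over the compact convex set `Θ`, and `θ_h → θ*` as
`h → 0⁺`, where `θ*` is the unique maximizer of `g(·, t₀)`. -/
theorem stmt_8 (q : ℕ) (hq : 1 ≤ q)
    (Θ : Set (EuclideanSpace ℝ (Fin q))) (hΘc : IsCompact Θ) (hΘconv : Convex ℝ Θ)
    (t₀ h₀ M : ℝ) (hh₀ : 0 < h₀)
    (g g' : EuclideanSpace ℝ (Fin q) → ℝ → ℝ)
    (hgcont : ContinuousOn (fun p : EuclideanSpace ℝ (Fin q) × ℝ => g p.1 p.2)
      (Θ ×ˢ Set.Icc (t₀ - h₀) (t₀ + h₀)))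
    (hg : ∀ θ ∈ Θ, ∀ s ∈ Set.Icc (t₀ - h₀) (t₀ + h₀), HasDerivAt (g θ) (g' θ s) s)
    (hg' : ∀ θ ∈ Θ, ∀ s ∈ Set.Icc (t₀ - h₀) (t₀ + h₀), |g' θ s| ≤ M)
    (hconc : ∀ s ∈ Set.Icc (t₀ - h₀) (t₀ + h₀), StrictConcaveOn ℝ Θ (fun θ => g θ s))
    (θstar : EuclideanSpace ℝ (Fin q)) (hθstar : θstar ∈ Θ)
    (hmax : ∀ θ ∈ Θ, θ ≠ θstar → g θ t₀ < g θstar t₀)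
    (K : ℝ → ℝ) (hK0 : ∀ u, 0 ≤ K u)
    (hKsupp : ∀ u, u ∉ Set.Icc (-1 : ℝ) 1 → K u = 0)
    (hK1 : (∫ u in (-1 : ℝ)..1, K u) = 1) :
    ∃ θh : ℝ → EuclideanSpace ℝ (Fin q),
      (∀ h ∈ Set.Ioc (0 : ℝ) h₀,
        θh h ∈ Θ ∧
        IsMaxOn (fun θ => ∫ u in (-1 : ℝ)..1, K u * g θ (t₀ + u * h)) Θ (θh h) ∧
        ∀ θ' ∈ Θ,
          IsMaxOn (fun θ => ∫ u in (-1 : ℝ)..1, K u * g θ (t₀ + u * h)) Θ θ' →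
            θ' = θh h) ∧
      Filter.Tendsto θh (nhdsWithin 0 (Set.Ioi 0)) (nhds θstar) := by
  have hK : IntervalIntegrable K volume (-1) 1 := by
    by_contra hnot
    rw [intervalIntegral.integral_undef hnot] at hK1
    exact zero_ne_one hK1
  have h11 : (-1 : ℝ) ≤ 1 := by norm_num
  have hK0' : ∀ u ∈ Set.Icc (-1 : ℝ) 1, 0 ≤ K u := fun u _ => hK0 u
  have hKpos : 0 < ∫ u in (-1 : ℝ)..1, K u := by rw [hK1]; exact one_pos
  have ht₀ : t₀ ∈ Set.Icc (t₀ - h₀) (t₀ + h₀) := ⟨by linarith, by linarith⟩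
  have hmem : ∀ h ∈ Set.Ioc (0 : ℝ) h₀, ∀ u ∈ Set.Icc (-1 : ℝ) 1,
      t₀ + u * h ∈ Set.Icc (t₀ - h₀) (t₀ + h₀) := fun h hh u hu =>
    ⟨by nlinarith [hh.1, hh.2, hu.1], by nlinarith [hh.1, hh.2, hu.2]⟩
  have hjoint : ∀ h ∈ Set.Ioc (0 : ℝ) h₀,
      ContinuousOn (fun p : EuclideanSpace ℝ (Fin q) × ℝ => g p.1 (t₀ + p.2 * h))
        (Θ ×ˢ Set.Icc (-1) 1) := fun h hh =>
    hgcont.comp (f := fun p : EuclideanSpace ℝ (Fin q) × ℝ => (p.1, t₀ + p.2 * h))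
      (by fun_prop) fun p hp => ⟨hp.1, hmem h hh p.2 hp.2⟩
  have hsec : ∀ h ∈ Set.Ioc (0 : ℝ) h₀, ∀ θ ∈ Θ,
      ContinuousOn (fun u => g θ (t₀ + u * h)) (Set.Icc (-1) 1) := fun h hh θ hθ =>
    (hjoint h hh).comp (f := fun u : ℝ => (θ, u)) (by fun_prop) fun u hu => ⟨hθ, hu⟩
  have hexists : ∀ h : ℝ, ∃ θ, h ∈ Set.Ioc (0 : ℝ) h₀ → θ ∈ Θ ∧
      IsMaxOn (fun θ => ∫ u in (-1 : ℝ)..1, K u * g θ (t₀ + u * h)) Θ θ := fun h => by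
    by_cases hh : h ∈ Set.Ioc (0 : ℝ) h₀
    · obtain ⟨θ, hθ, hθmax⟩ := hΘc.exists_isMaxOn ⟨θstar, hθstar⟩
        (continuousOn_intervalIntegral_kernel_mul (f := fun θ u => g θ (t₀ + u * h))
          hΘc h11 hK (hjoint h hh))
      exact ⟨θ, fun _ => ⟨hθ, hθmax⟩⟩
    · exact ⟨θstar, fun hh' => absurd hh' hh⟩
  choose θh hθh using hexists
  refine ⟨θh, fun h hh => ⟨(hθh h hh).1, (hθh h hh).2, fun θ' hθ' hθ'max => ?_⟩, ?_⟩
  · exact (strictConcaveOn_intervalIntegral_kernel_mul (f := fun θ u => g θ (t₀ + u * h))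
      hΘconv h11 hK hK0' hKpos (hsec h hh) fun u hu => hconc _ (hmem h hh u hu)).eq_of_isMaxOn
      hθ'max (hθh h hh).2 hθ' (hθh h hh).1
  · have hM : 0 ≤ M := (abs_nonneg _).trans (hg' θstar hθstar t₀ ht₀)
    have hsmall : ∀ᶠ h in nhdsWithin (0 : ℝ) (Set.Ioi 0), h ∈ Set.Ioc (0 : ℝ) h₀ :=
      Ioc_mem_nhdsGT hh₀
    refine tendsto_of_isMaxOn_of_uniform_approx hΘc (f := fun θ => g θ t₀)
      (F := fun h θ => ∫ u in (-1 : ℝ)..1, K u * g θ (t₀ + u * h)) (ε := fun h => M * h)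
      (hgcont.comp (f := fun θ => (θ, t₀)) (by fun_prop) fun θ hθ => ⟨hθ, ht₀⟩)
      hθstar hmax ?_ ?_ (hsmall.mono hθh)
    · have hcont : Continuous fun h : ℝ => M * h := by fun_prop
      simpa using (hcont.tendsto 0).mono_left nhdsWithin_le_nhds
    · filter_upwards [hsmall] with h hh θ hθ
      refine abs_intervalIntegral_kernel_mul_sub_le h11 hK hK0' hK1 (hsec h hh θ hθ)
        fun u hu => ?_
      have hmv := (convex_Icc (t₀ - h₀) (t₀ + h₀)).norm_image_sub_le_of_norm_hasDerivWithin_le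
        (fun s hs => (hg θ hθ s hs).hasDerivWithinAt) (hg' θ hθ) ht₀ (hmem h hh u hu)
      rw [add_sub_cancel_left, Real.norm_eq_abs, Real.norm_eq_abs, abs_mul,
        abs_of_pos hh.1] at hmv
      exact hmv.trans (mul_le_mul_of_nonneg_left
        (mul_le_of_le_one_left hh.1.le (abs_le.mpr hu)) hM)
end
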